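/- Given f_i ∈ C^∞(S³), let u_i be the biharmonic extension of f_i to 𝔹⁴ with zero Neumann boundary condition, i.e. Δ²u_i = 0 in 𝔹⁴, u_i = f_i and ∂u_i/∂r = 0 on S³. Assume that, as i → ∞, u_i ⇀ 0 weakly in H²(𝔹⁴) and u_i → 0 in H¹(𝔹⁴). Let φ ∈ C^∞(closure of 𝔹⁴) satisfy ∂φ/∂r = 0 on S³, and let U_i be the biharmonic extension of φ f_i to 𝔹⁴ with zero Neumann boundary condition (Δ²U_i = 0 in 𝔹⁴, U_i = φ f_i and ∂U_i/∂r = 0 on S³). Then lim_{i → ∞} ‖φ u_i − U_i‖_{H²(𝔹⁴)} = 0. -/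

import Mathlib

open MeasureTheory Metric Filter
open scoped ENNReal RealInnerProductSpace

noncomputable section

abbrev E (n : ℕ) : Type := EuclideanSpace ℝ (Fin n)

/-- The Euclidean Laplacian `Δu = Σ_i ∂²u/∂x_i²`. -/
def lap (n : ℕ) (u : E n → ℝ) (x : E n) : ℝ :=
  ∑ i : Fin n, fderiv ℝ (fun y => fderiv ℝ u y (EuclideanSpace.single i 1)) x
    (EuclideanSpace.single i 1)

/-- The squared `H²(𝔹⁴)` norm of a function. -/
def H2normSq (u : E 4 → ℝ) : ℝ :=
  ∫ x in Metric.ball (0 : E 4) 1,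
    ((u x) ^ 2 + ‖fderiv ℝ u x‖ ^ 2 + ‖iteratedFDeriv ℝ 2 u x‖ ^ 2)

/-- partial derivative -/
def pd (i : Fin 4) (g : E 4 → ℝ) (x : E 4) : ℝ := fderiv ℝ g x (EuclideanSpace.single i 1)

/-- smooth functions -/
abbrev Sm (g : E 4 → ℝ) : Prop := ContDiff ℝ (⊤ : ℕ∞) g

/-- vanishing on the sphere -/
def Van (g : E 4 → ℝ) : Prop := ∀ x ∈ Metric.sphere (0 : E 4) 1, g x = 0

theorem Sm.pd {g : E 4 → ℝ} (hg : Sm g) (i : Fin 4) : Sm (pd i g) := by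
  have h1 : ContDiff ℝ (⊤ : ℕ∞) (fderiv ℝ g) := hg.fderiv_right (by norm_cast)
  exact h1.clm_apply contDiff_const

theorem Sm.diff {g : E 4 → ℝ} (hg : Sm g) (x : E 4) : DifferentiableAt ℝ g x :=
  (hg.differentiable (by simp)) x

theorem sm_lap {g : E 4 → ℝ} (hg : Sm g) : Sm (lap 4 g) := by
  have : lap 4 g = fun x => ∑ i : Fin 4, pd i (pd i g) x := rfl
  rw [this]
  exact ContDiff.sum fun i _ => (hg.pd i).pd i

theorem lap_eq (g : E 4 → ℝ) (x : E 4) : lap 4 g x = ∑ i : Fin 4, pd i (pd i g) x := rfl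

theorem pd_mul {a b : E 4 → ℝ} (ha : Sm a) (hb : Sm b) (i : Fin 4) (x : E 4) :
    pd i (fun y => a y * b y) x = a x * pd i b x + pd i a x * b x := by
  unfold pd
  rw [fderiv_fun_mul (ha.diff x) (hb.diff x)]
  simp [mul_comm]

theorem pd_add {a b : E 4 → ℝ} (ha : Sm a) (hb : Sm b) (i : Fin 4) (x : E 4) :
    pd i (fun y => a y + b y) x = pd i a x + pd i b x := by
  unfold pd
  rw [fderiv_fun_add (ha.diff x) (hb.diff x)]
  simp

theorem pd_sub {a b : E 4 → ℝ} (ha : Sm a) (hb : Sm b) (i : Fin 4) (x : E 4) :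
    pd i (fun y => a y - b y) x = pd i a x - pd i b x := by
  unfold pd
  rw [fderiv_fun_sub (ha.diff x) (hb.diff x)]
  simp

theorem pd_sum {a : Fin 4 → E 4 → ℝ} (ha : ∀ j, Sm (a j)) (i : Fin 4) (x : E 4) :
    pd i (fun y => ∑ j, a j y) x = ∑ j, pd i (a j) x := by
  unfold pd
  rw [fderiv_fun_sum (fun j _ => (ha j).diff x)]
  simp

theorem fderiv_pd {g : E 4 → ℝ} (hg : Sm g) (j : Fin 4) (x v : E 4) :
    fderiv ℝ (pd j g) x v = fderiv ℝ (fderiv ℝ g) x v (EuclideanSpace.single j 1) := by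
  have h1 : ContDiff ℝ (⊤ : ℕ∞) (fderiv ℝ g) := hg.fderiv_right (by norm_cast)
  have h2 : DifferentiableAt ℝ (fderiv ℝ g) x := (h1.differentiable (by simp)) x
  have h3 : pd j g = fun y => fderiv ℝ g y (EuclideanSpace.single j 1) := rfl
  rw [h3, fderiv_clm_apply h2 (differentiableAt_const _)]
  simp

theorem pd_comm {g : E 4 → ℝ} (hg : Sm g) (i j : Fin 4) : pd i (pd j g) = pd j (pd i g) := by
  funext x
  have hs : IsSymmSndFDerivAt ℝ g x := (hg.contDiffAt).isSymmSndFDerivAt (by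
    simp; norm_cast)
  have e1 := fderiv_pd hg j x (EuclideanSpace.single i 1)
  have e2 := fderiv_pd hg i x (EuclideanSpace.single j 1)
  show fderiv ℝ (pd j g) x _ = fderiv ℝ (pd i g) x _
  rw [e1, e2]
  exact hs _ _

theorem lip_ext {g : E 4 → ℝ} (hg : Sm g) (h0 : Van g) :
    ∃ C, LipschitzWith C (Set.indicator (ball (0 : E 4) 1) g) := by
  obtain ⟨C, hC⟩ := (ContDiffOn.exists_lipschitzOnWith (hg.contDiffOn (s := closedBall (0 : E 4) 1)) (by simp)
    (convex_closedBall _ _) (isCompact_closedBall _ _))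
  refine ⟨C, ?_⟩
  have key : ∀ x ∈ ball (0 : E 4) 1, ∀ y ∉ ball (0 : E 4) 1, dist (g x) 0 ≤ C * dist x y := by
    intro x hx y hy
    have hc : ContinuousOn (fun t : ℝ => ‖AffineMap.lineMap x y t‖) (Set.Icc (0 : ℝ) 1) := by
      apply Continuous.continuousOn
      exact (AffineMap.lineMap_continuous).norm
    have := intermediate_value_Icc (zero_le_one) hc
    have h1 : (1 : ℝ) ∈ Set.Icc (‖AffineMap.lineMap x y (0 : ℝ)‖) (‖AffineMap.lineMap x y (1 : ℝ)‖) := by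
      simp at hx hy ⊢
      exact ⟨hx.le, hy⟩
    obtain ⟨t, ht, hz⟩ := this h1
    simp only at hz
    set z : E 4 := AffineMap.lineMap x y t
    have hzs : z ∈ sphere (0 : E 4) 1 := by simpa using hz
    have h2 := hC.dist_le_mul x (ball_subset_closedBall hx) z (sphere_subset_closedBall hzs)
    rw [h0 z hzs] at h2
    refine h2.trans ?_
    gcongr
    rw [dist_left_lineMap]
    rw [Real.norm_of_nonneg ht.1]
    exact mul_le_of_le_one_left dist_nonneg ht.2
  refine LipschitzWith.of_dist_le_mul fun x y => ?_
  by_cases hx : x ∈ ball (0 : E 4) 1 <;> by_cases hy : y ∈ ball (0 : E 4) 1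
  · rw [Set.indicator_of_mem hx, Set.indicator_of_mem hy]
    exact hC.dist_le_mul x (ball_subset_closedBall hx) y (ball_subset_closedBall hy)
  · rw [Set.indicator_of_mem hx, Set.indicator_of_notMem hy]
    exact key x hx y hy
  · rw [Set.indicator_of_notMem hx, Set.indicator_of_mem hy, dist_comm, dist_comm x y]
    exact key y hy x hx
  · rw [Set.indicator_of_notMem hx, Set.indicator_of_notMem hy]
    simp; positivity

theorem int_pd {g : E 4 → ℝ} (hg : Sm g) (h0 : Van g) (i : Fin 4) :
    ∫ x in ball (0 : E 4) 1, pd i g x = 0 := by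
  obtain ⟨C, hC⟩ := lip_ext hg h0
  have hcs : HasCompactSupport (Set.indicator (ball (0 : E 4) 1) g) := by
    apply HasCompactSupport.of_support_subset_isCompact (isCompact_closedBall (0 : E 4) 1)
    exact (Set.support_indicator_subset).trans ball_subset_closedBall
  have h1 : LipschitzWith 0 (fun _ : E 4 => (1 : ℝ)) := LipschitzWith.const _
  have := LipschitzWith.integral_lineDeriv_mul_eq (μ := volume) h1 hC hcs (-(EuclideanSpace.single i (1 : ℝ)))
  rw [← integral_indicator measurableSet_ball]
  have h2 : ∀ x : E 4, lineDeriv ℝ (fun _ : E 4 => (1 : ℝ)) x (-(EuclideanSpace.single i (1 : ℝ))) = 0 := by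
    intro x; simp [lineDeriv]
  simp only [h2, zero_mul, integral_zero, neg_neg, mul_one] at this
  rw [this]
  apply integral_congr_ae
  have hs : ∀ᵐ x ∂(volume : Measure (E 4)), x ∉ sphere (0 : E 4) 1 :=
    measure_eq_zero_iff_ae_notMem.mp (Measure.addHaar_sphere volume 0 1)
  filter_upwards [hs] with x hx
  by_cases hb : x ∈ ball (0 : E 4) 1
  · rw [Set.indicator_of_mem hb]
    have he : Set.indicator (ball (0 : E 4) 1) g =ᶠ[nhds x] g := by
      filter_upwards [isOpen_ball.mem_nhds hb] with y hy
      rw [Set.indicator_of_mem hy]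
    rw [he.lineDeriv_eq, (hg.diff x).lineDeriv_eq_fderiv]
    rfl
  · rw [Set.indicator_of_notMem hb]
    have hc : x ∈ (closedBall (0 : E 4) 1)ᶜ := by
      simp at hx hb ⊢
      exact lt_of_le_of_ne hb (Ne.symm hx)
    have he : Set.indicator (ball (0 : E 4) 1) g =ᶠ[nhds x] fun _ => 0 := by
      filter_upwards [isClosed_closedBall.isOpen_compl.mem_nhds hc] with y hy
      rw [Set.indicator_of_notMem]
      exact fun h => hy (ball_subset_closedBall h)
    rw [he.lineDeriv_eq]
    simp [lineDeriv]

theorem Sm.intg {g : E 4 → ℝ} (hg : Continuous g) : IntegrableOn g (ball (0 : E 4) 1) :=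
  (hg.continuousOn.integrableOn_compact (isCompact_closedBall (0 : E 4) 1)).mono_set
    ball_subset_closedBall

/-- integration by parts -/
theorem ibp {a b : E 4 → ℝ} (ha : Sm a) (hb : Sm b) (h0 : Van (fun x => a x * b x)) (i : Fin 4) :
    ∫ x in ball (0 : E 4) 1, a x * pd i b x = - ∫ x in ball (0 : E 4) 1, pd i a x * b x := by
  have h := int_pd (ha.mul hb) h0 i
  have e : (fun x => pd i (fun y => a y * b y) x) = fun x => a x * pd i b x + pd i a x * b x :=
    funext fun x => pd_mul ha hb i x
  rw [e, integral_add] at h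
  · linarith
  · exact Sm.intg (ha.continuous.mul (hb.pd i).continuous)
  · exact Sm.intg ((ha.pd i).continuous.mul hb.continuous)

theorem Van.mul_left {b : E 4 → ℝ} (h : Van b) (a : E 4 → ℝ) : Van (fun x => a x * b x) :=
  fun x hx => by simp [h x hx]

theorem Van.mul_right {a : E 4 → ℝ} (h : Van a) (b : E 4 → ℝ) : Van (fun x => a x * b x) :=
  fun x hx => by simp [h x hx]

theorem van_pd {w : E 4 → ℝ} (hw : Sm w) (h0 : Van w)
    (hn : ∀ x ∈ sphere (0 : E 4) 1, fderiv ℝ w x x = 0) (i : Fin 4) : Van (pd i w) := by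
  intro x hx
  have hx1 : ‖x‖ = 1 := by simpa using hx
  have tang : ∀ v : E 4, ‖v‖ = 1 → ⟪x, v⟫ = 0 → fderiv ℝ w x v = 0 := by
    intro v hv hxv
    have hc : HasDerivAt (fun t : ℝ => Real.cos t • x + Real.sin t • v)
        (-Real.sin 0 • x + Real.cos 0 • v) 0 :=
      ((Real.hasDerivAt_cos 0).smul_const x).add ((Real.hasDerivAt_sin 0).smul_const v)
    have hf : HasFDerivAt w (fderiv ℝ w x) (Real.cos 0 • x + Real.sin 0 • v) := by
      simpa using (hw.diff x).hasFDerivAt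
    have h1 := hf.comp_hasDerivAt (0 : ℝ) hc
    have h2 : (w ∘ fun t : ℝ => Real.cos t • x + Real.sin t • v) = fun _ => 0 := by
      funext t
      apply h0
      have : ‖Real.cos t • x + Real.sin t • v‖ ^ 2 = 1 := by
        rw [norm_add_sq_real, norm_smul, norm_smul, inner_smul_left, inner_smul_right, hxv, hx1, hv]
        simp
      simp only [mem_sphere_iff_norm, sub_zero]
      nlinarith [norm_nonneg (Real.cos t • x + Real.sin t • v)]
    rw [h2] at h1
    have h3 := h1.unique (hasDerivAt_const (0 : ℝ) (0 : ℝ))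
    simpa using h3
  have all : ∀ v : E 4, fderiv ℝ w x v = 0 := by
    intro v
    set p := v - ⟪x, v⟫ • x with hp
    have hxp : ⟪x, p⟫ = 0 := by
      rw [hp, inner_sub_right, inner_smul_right, real_inner_self_eq_norm_sq, hx1]; simp
    have hvp : v = p + ⟪x, v⟫ • x := by rw [hp]; simp
    have hpz : fderiv ℝ w x p = 0 := by
      by_cases h : p = 0
      · simp [h]
      · have hn' : ‖p‖ ≠ 0 := norm_ne_zero_iff.mpr h
        have := tang (‖p‖⁻¹ • p) (by rw [norm_smul]; simp [hn']) (by rw [inner_smul_right, hxp]; simp)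
        rw [map_smul, smul_eq_mul] at this
        simpa [hn'] using this
    rw [hvp, map_add, map_smul, hpz, hn x hx]; simp
  exact all _

theorem lap_mul {a b : E 4 → ℝ} (ha : Sm a) (hb : Sm b) (x : E 4) :
    lap 4 (fun y => a y * b y) x
      = a x * lap 4 b x + (∑ j, 2 * (pd j a x * pd j b x) + lap 4 a x * b x) := by
  simp only [lap_eq]
  rw [Finset.mul_sum, Finset.sum_mul, ← Finset.sum_add_distrib, ← Finset.sum_add_distrib]
  refine Finset.sum_congr rfl fun i _ => ?_
  have e : pd i (fun y => a y * b y) = fun y => a y * pd i b y + pd i a y * b y :=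
    funext fun y => pd_mul ha hb i y
  rw [e, pd_add (ha.mul (hb.pd i)) ((ha.pd i).mul hb), pd_mul ha (hb.pd i), pd_mul (ha.pd i) hb]
  ring

theorem lap_sub {a b : E 4 → ℝ} (ha : Sm a) (hb : Sm b) (x : E 4) :
    lap 4 (fun y => a y - b y) x = lap 4 a x - lap 4 b x := by
  simp only [lap_eq]
  rw [← Finset.sum_sub_distrib]
  refine Finset.sum_congr rfl fun i _ => ?_
  have e : pd i (fun y => a y - b y) = fun y => pd i a y - pd i b y :=
    funext fun y => pd_sub ha hb i y
  rw [e, pd_sub (ha.pd i) (hb.pd i)]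

theorem poincare {v : E 4 → ℝ} (hv : Sm v) (h0 : Van v) (i : Fin 4) :
    ∫ x in ball (0 : E 4) 1, v x ^ 2 ≤ 4 * ∫ x in ball (0 : E 4) 1, pd i v x ^ 2 := by
  have hc : Sm (fun x : E 4 => x i) := (EuclideanSpace.proj (𝕜 := ℝ) i).contDiff
  have hpc : ∀ x, pd i (fun x : E 4 => x i) x = 1 := by
    intro x
    have : fderiv ℝ (fun x : E 4 => x i) x = EuclideanSpace.proj (𝕜 := ℝ) i :=
      (EuclideanSpace.proj (𝕜 := ℝ) i).fderiv
    unfold pd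
    rw [this]; simp
  have hv2 : Sm (fun x => v x * v x) := hv.mul hv
  have h := ibp hv2 hc ((h0.mul_right v).mul_right _) i
  simp only [hpc, mul_one] at h
  have e : ∀ x, pd i (fun x => v x * v x) x = v x * pd i v x + pd i v x * v x :=
    fun x => pd_mul hv hv i x
  simp only [e] at h
  rw [← integral_neg] at h
  have c1 := hv.continuous
  have c2 := (hv.pd i).continuous
  have c3 := hc.continuous
  have hle : ∫ x in ball (0 : E 4) 1, -((v x * pd i v x + pd i v x * v x) * x i)
      ≤ ∫ x in ball (0 : E 4) 1, ((1 / 2) * (v x * v x) + 2 * pd i v x ^ 2) := by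
    apply setIntegral_mono_on
    · exact Sm.intg (by fun_prop)
    · exact Sm.intg (by fun_prop)
    · exact measurableSet_ball
    · intro x hx
      have h1 : |x i| ≤ 1 := by
        have := EuclideanSpace.norm_eq x
        have h2 := PiLp.norm_apply_le x i
        have h3 : ‖x‖ < 1 := by simpa using hx
        rw [Real.norm_eq_abs] at h2
        linarith
      have h2 : x i ^ 2 ≤ 1 := (sq_le_one_iff_abs_le_one _).mpr h1
      nlinarith [sq_nonneg (v x + 2 * (x i * pd i v x)), sq_nonneg (pd i v x)]
  rw [← h, integral_add, integral_const_mul, integral_const_mul] at hle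
  · have : (fun x => v x ^ 2) = fun x => v x * v x := by funext x; ring
    rw [this]
    linarith
  · exact Sm.intg (by fun_prop)
  · exact Sm.intg (by fun_prop)

theorem green {u ψ : E 4 → ℝ} (hu : Sm u) (hψ : Sm ψ) (h0 : Van ψ) (h1 : ∀ i, Van (pd i ψ))
    (hb : ∀ x ∈ ball (0 : E 4) 1, lap 4 (lap 4 u) x = 0) :
    ∫ x in ball (0 : E 4) 1, lap 4 u x * lap 4 ψ x = 0 := by
  have hL := sm_lap hu
  have e : ∀ x, lap 4 u x * lap 4 ψ x = ∑ i, lap 4 u x * pd i (pd i ψ) x := by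
    intro x; rw [lap_eq ψ, Finset.mul_sum]
  simp only [e]
  rw [integral_finsetSum (f := fun i x => lap 4 u x * pd i (pd i ψ) x) _
    (fun i _ => Sm.intg (hL.continuous.mul ((hψ.pd i).pd i).continuous))]
  have e2 : ∀ i : Fin 4, ∫ x in ball (0 : E 4) 1, lap 4 u x * pd i (pd i ψ) x
      = ∫ x in ball (0 : E 4) 1, pd i (pd i (lap 4 u)) x * ψ x := by
    intro i
    rw [ibp hL (hψ.pd i) ((h1 i).mul_left _) i, ibp (hL.pd i) hψ (h0.mul_left _) i, neg_neg]
  simp only [e2]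
  rw [← integral_finsetSum (f := fun i x => pd i (pd i (lap 4 u)) x * ψ x) _
    (fun i _ => Sm.intg (((hL.pd i).pd i).continuous.mul hψ.continuous))]
  have : ∫ x in ball (0 : E 4) 1, ∑ i, pd i (pd i (lap 4 u)) x * ψ x
      = ∫ x in ball (0 : E 4) 1, (0 : ℝ) := by
    apply setIntegral_congr_fun measurableSet_ball
    intro x hx
    simp only
    rw [← Finset.sum_mul, ← lap_eq, hb x hx, zero_mul]
  rw [this]; simp

theorem hess {w : E 4 → ℝ} (hw : Sm w) (h1 : ∀ i, Van (pd i w)) :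
    ∫ x in ball (0 : E 4) 1, lap 4 w x * lap 4 w x
      = ∑ j, ∑ i, ∫ x in ball (0 : E 4) 1, pd i (pd j w) x ^ 2 := by
  have e : ∀ x, lap 4 w x * lap 4 w x = ∑ j, ∑ i, pd i (pd i w) x * pd j (pd j w) x := by
    intro x; rw [lap_eq w, Finset.sum_mul_sum, Finset.sum_comm]
  have c : ∀ i j : Fin 4, Continuous (pd i (pd j w)) := fun i j => ((hw.pd j).pd i).continuous
  simp only [e]
  rw [integral_finsetSum]
  · refine Finset.sum_congr rfl fun j _ => ?_
    rw [integral_finsetSum]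
    · refine Finset.sum_congr rfl fun i _ => ?_
      rw [ibp ((hw.pd i).pd i) (hw.pd j) ((h1 j).mul_left _) j]
      have : (fun x => pd i (pd j w) x ^ 2) = fun x => pd i (pd j w) x * pd i (pd j w) x := by
        funext x; ring
      rw [this, ibp ((hw.pd j).pd i) (hw.pd j) ((h1 j).mul_left _) i]
      rw [pd_comm (hw.pd i) j i, pd_comm hw j i]
    · intro i _
      exact Sm.intg ((c i i).mul (c j j))
  · intro j _
    exact Sm.intg (continuous_finsetSum _ fun i _ => (c i i).mul (c j j))

/-- the coordinate `H²` density -/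
def Q (w : E 4 → ℝ) (x : E 4) : ℝ :=
  w x ^ 2 + ∑ j, pd j w x ^ 2 + ∑ j, ∑ i, pd i (pd j w) x ^ 2

theorem contQ {w : E 4 → ℝ} (hw : Sm w) : Continuous (Q w) := by
  have c0 := hw.continuous
  have c1 : ∀ i : Fin 4, Continuous (pd i w) := fun i => (hw.pd i).continuous
  have c2 : ∀ i j : Fin 4, Continuous (pd i (pd j w)) := fun i j => ((hw.pd j).pd i).continuous
  unfold Q
  fun_prop

theorem intQ {w : E 4 → ℝ} (hw : Sm w) (h0 : Van w) (h1 : ∀ i, Van (pd i w)) :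
    ∫ x in ball (0 : E 4) 1, Q w x ≤ 21 * ∫ x in ball (0 : E 4) 1, lap 4 w x * lap 4 w x := by
  have c0 := hw.continuous
  have c1 : ∀ i : Fin 4, Continuous (pd i w) := fun i => (hw.pd i).continuous
  have c2 : ∀ i j : Fin 4, Continuous (pd i (pd j w)) := fun i j => ((hw.pd j).pd i).continuous
  rw [hess hw h1]
  have e : ∫ x in ball (0 : E 4) 1, Q w x = (∫ x in ball (0 : E 4) 1, w x ^ 2)
      + (∑ j, ∫ x in ball (0 : E 4) 1, pd j w x ^ 2)
      + ∑ j, ∑ i, ∫ x in ball (0 : E 4) 1, pd i (pd j w) x ^ 2 := by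
    unfold Q
    rw [integral_add, integral_add, integral_finsetSum, integral_finsetSum]
    · congr 1
      refine Finset.sum_congr rfl fun j _ => ?_
      rw [integral_finsetSum]
      intro i _
      exact Sm.intg (by fun_prop)
    all_goals first
      | (intro j _; exact Sm.intg (by fun_prop))
      | exact Sm.intg (by fun_prop)
  rw [e]
  have n1 : ∀ j, 0 ≤ ∫ x in ball (0 : E 4) 1, pd j w x ^ 2 :=
    fun j => integral_nonneg fun x => sq_nonneg _
  have n2 : ∀ i j, 0 ≤ ∫ x in ball (0 : E 4) 1, pd i (pd j w) x ^ 2 :=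
    fun i j => integral_nonneg fun x => sq_nonneg _
  have p0 := poincare hw h0 0
  have p0' : ∫ x in ball (0 : E 4) 1, pd 0 w x ^ 2 ≤ ∑ j, ∫ x in ball (0 : E 4) 1, pd j w x ^ 2 :=
    Finset.single_le_sum (f := fun j => ∫ x in ball (0 : E 4) 1, pd j w x ^ 2)
      (fun j _ => n1 j) (Finset.mem_univ _)
  have p1 : ∑ j, ∫ x in ball (0 : E 4) 1, pd j w x ^ 2
      ≤ 4 * ∑ j, ∑ i, ∫ x in ball (0 : E 4) 1, pd i (pd j w) x ^ 2 := by
    rw [Finset.mul_sum]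
    refine Finset.sum_le_sum fun j _ => (poincare (hw.pd j) (h1 j) 0).trans ?_
    gcongr
    exact Finset.single_le_sum (f := fun i => ∫ x in ball (0 : E 4) 1, pd i (pd j w) x ^ 2)
      (fun i _ => n2 i j) (Finset.mem_univ _)
  linarith

/-- first order commutator -/
def comm1 (φ u : E 4 → ℝ) (x : E 4) : ℝ := ∑ j, 2 * (pd j φ x * pd j u x) + lap 4 φ x * u x

theorem sm_comm1 {φ u : E 4 → ℝ} (hφ : Sm φ) (hu : Sm u) : Sm (comm1 φ u) := by
  unfold comm1
  apply ContDiff.add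
  · exact ContDiff.sum fun j _ => contDiff_const.mul ((hφ.pd j).mul (hu.pd j))
  · exact (sm_lap hφ).mul hu

theorem main_id {φ u U w : E 4 → ℝ} (hφ : Sm φ) (hu : Sm u) (hU : Sm U)
    (hwd : w = fun y => φ y * u y - U y)
    (h0 : Van w) (h1 : ∀ i, Van (pd i w))
    (hb : ∀ x ∈ ball (0 : E 4) 1, lap 4 (lap 4 u) x = 0)
    (hbU : ∀ x ∈ ball (0 : E 4) 1, lap 4 (lap 4 U) x = 0) :
    ∫ x in ball (0 : E 4) 1, lap 4 w x * lap 4 w x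
      = (∫ x in ball (0 : E 4) 1, comm1 φ u x * lap 4 w x)
        + ∑ k, ∫ x in ball (0 : E 4) 1, pd k (comm1 φ w) x * pd k u x := by
  have hw : Sm w := by rw [hwd]; exact (hφ.mul hu).sub hU
  have hB := sm_comm1 hφ hw
  have hA := sm_comm1 hφ hu
  have cφ := hφ.continuous
  have cLu := (sm_lap hu).continuous
  have cLw := (sm_lap hw).continuous
  have cLU := (sm_lap hU).continuous
  have cA := hA.continuous
  have cB := hB.continuous
  have e1 : ∀ x, lap 4 w x * lap 4 w x = (φ x * lap 4 u x * lap 4 w x + comm1 φ u x * lap 4 w x)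
      - lap 4 U x * lap 4 w x := by
    intro x
    have : lap 4 w x = φ x * lap 4 u x + comm1 φ u x - lap 4 U x := by
      conv_lhs => rw [hwd]
      rw [lap_sub (hφ.mul hu) hU, lap_mul hφ hu]; rfl
    nth_rewrite 1 [this]; ring
  have g1 := green hU hw h0 h1 hbU
  have vB : Van (comm1 φ w) := by
    intro x hx
    unfold comm1
    have hz : ∀ j, pd j w x = 0 := fun j => h1 j x hx
    simp [hz, h0 x hx]
  have g2 := green hu (hφ.mul hw) (h0.mul_left φ) (by
    intro i x hx
    have := pd_mul hφ hw i x
    rw [this, h0 x hx, h1 i x hx]; simp) hb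
  have e2 : ∀ x, lap 4 u x * lap 4 (fun y => φ y * w y) x
      = φ x * lap 4 u x * lap 4 w x + lap 4 u x * comm1 φ w x := by
    intro x
    rw [lap_mul hφ hw]; unfold comm1; ring
  have e3 : ∫ x in ball (0 : E 4) 1, lap 4 u x * comm1 φ w x
      = - ∑ k, ∫ x in ball (0 : E 4) 1, pd k (comm1 φ w) x * pd k u x := by
    have : ∀ x, lap 4 u x * comm1 φ w x = ∑ k, comm1 φ w x * pd k (pd k u) x := by
      intro x; rw [lap_eq u, Finset.sum_mul]
      exact Finset.sum_congr rfl fun i _ => mul_comm _ _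
    simp only [this]
    rw [integral_finsetSum (f := fun k x => comm1 φ w x * pd k (pd k u) x) _
      (fun i _ => Sm.intg (cB.mul ((hu.pd i).pd i).continuous)),
      ← Finset.sum_neg_distrib]
    exact Finset.sum_congr rfl fun k _ => ibp hB (hu.pd k) (vB.mul_right _) k
  change ∫ x in ball (0 : E 4) 1, lap 4 u x * lap 4 (fun y => φ y * w y) x = 0 at g2
  simp only [e2] at g2
  rw [integral_add, e3] at g2
  · simp only [e1]
    rw [integral_sub, integral_add, g1]
    · linarith
    all_goals exact Sm.intg (by fun_prop)
  all_goals exact Sm.intg (by fun_prop)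

/-- uniform domination of squares -/
def Dom (F G : ℕ → E 4 → ℝ) : Prop :=
  ∃ C : ℝ, 0 ≤ C ∧ ∀ i, ∀ x ∈ ball (0 : E 4) 1, F i x ^ 2 ≤ C * G i x

theorem Dom.add {F H G : ℕ → E 4 → ℝ} (hF : Dom F G) (hH : Dom H G) :
    Dom (fun i x => F i x + H i x) G := by
  obtain ⟨C, hC, h⟩ := hF
  obtain ⟨D, hD, h'⟩ := hH
  refine ⟨2 * C + 2 * D, by positivity, fun i x hx => ?_⟩
  have := h i x hx
  have := h' i x hx
  nlinarith [sq_nonneg (F i x - H i x)]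

theorem Dom.sum {F : Fin 4 → ℕ → E 4 → ℝ} {G : ℕ → E 4 → ℝ} (hF : ∀ j, Dom (F j) G) :
    Dom (fun i x => ∑ j, F j i x) G := by
  simp only [Fin.sum_univ_four]
  exact (((hF 0).add (hF 1)).add (hF 2)).add (hF 3)

theorem Dom.bmul {F G : ℕ → E 4 → ℝ} (hF : Dom F G) {p : E 4 → ℝ} (hp : Continuous p) :
    Dom (fun i x => p x * F i x) G := by
  obtain ⟨C, hC, h⟩ := hF
  obtain ⟨M, hM⟩ := (isCompact_closedBall (0 : E 4) 1).exists_bound_of_continuousOn hp.continuousOn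
  refine ⟨M ^ 2 * C, by positivity, fun i x hx => ?_⟩
  have h1 := hM x (ball_subset_closedBall hx)
  have h2 : p x ^ 2 ≤ M ^ 2 := by
    rw [← sq_abs (p x)]
    exact pow_le_pow_left₀ (abs_nonneg _) h1 2
  have h3 := h i x hx
  rw [mul_pow, mul_assoc]
  exact mul_le_mul h2 h3 (sq_nonneg _) (sq_nonneg _)

theorem Dom.int {F H G K : ℕ → E 4 → ℝ} (hF : Dom F G) (hH : Dom H K)
    (cF : ∀ i, Continuous (F i)) (cH : ∀ i, Continuous (H i)) (cG : ∀ i, Continuous (G i))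
    (cK : ∀ i, Continuous (K i)) (ε : ℝ) (hε : 0 < ε) (hK : ∀ i x, 0 ≤ K i x) :
    ∃ C : ℝ, ∀ i, ∫ x in ball (0 : E 4) 1, F i x * H i x
      ≤ C * (∫ x in ball (0 : E 4) 1, G i x) + ε * ∫ x in ball (0 : E 4) 1, K i x := by
  obtain ⟨C, hC, h⟩ := hF
  obtain ⟨D, hD, h'⟩ := hH
  set δ := ε / (D + 1) with hδ
  have hδp : 0 < δ := by positivity
  have hδD : δ * D ≤ ε := by
    rw [hδ, div_mul_eq_mul_div, div_le_iff₀ (by positivity)]; nlinarith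
  refine ⟨δ⁻¹ * C, fun i => ?_⟩
  rw [← integral_const_mul, ← integral_const_mul, ← integral_add]
  · apply setIntegral_mono_on
    · exact Sm.intg ((cF i).mul (cH i))
    · exact Sm.intg ((continuous_const.mul (cG i)).add (continuous_const.mul (cK i)))
    · exact measurableSet_ball
    · intro x hx
      have h1 : δ⁻¹ * F i x ^ 2 ≤ δ⁻¹ * C * G i x := by
        rw [mul_assoc]; exact mul_le_mul_of_nonneg_left (h i x hx) (by positivity)
      have h2 : δ * H i x ^ 2 ≤ ε * K i x := by
        calc δ * H i x ^ 2 ≤ δ * (D * K i x) := mul_le_mul_of_nonneg_left (h' i x hx) hδp.le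
          _ = δ * D * K i x := by ring
          _ ≤ ε * K i x := mul_le_mul_of_nonneg_right hδD (hK i x)
      have h3 : 2 * (F i x * H i x) ≤ δ⁻¹ * F i x ^ 2 + δ * H i x ^ 2 := by
        have e : δ⁻¹ * F i x ^ 2 + δ * H i x ^ 2 - 2 * (F i x * H i x)
            = δ⁻¹ * (F i x - δ * H i x) ^ 2 := by field_simp; ring
        have : 0 ≤ δ⁻¹ * (F i x - δ * H i x) ^ 2 := by positivity
        linarith
      have h4 : 0 ≤ δ⁻¹ * F i x ^ 2 := by positivity
      have h5 : 0 ≤ δ * H i x ^ 2 := by positivity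
      linarith
  · exact Sm.intg (continuous_const.mul (cG i))
  · exact Sm.intg (continuous_const.mul (cK i))

theorem pd_sq_le (u : E 4 → ℝ) (j : Fin 4) (x : E 4) : pd j u x ^ 2 ≤ ‖fderiv ℝ u x‖ ^ 2 := by
  have h := (fderiv ℝ u x).le_opNorm (EuclideanSpace.single j (1 : ℝ))
  simp only [EuclideanSpace.norm_single, norm_one, mul_one] at h
  rw [← sq_abs (pd j u x)]
  exact pow_le_pow_left₀ (abs_nonneg _) h 2

theorem vec_sum (v : E 4) : v = ∑ j, v j • EuclideanSpace.single j (1 : ℝ) := by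
  ext i
  simp [Fin.sum_univ_four]
  fin_cases i <;> simp

theorem fderiv_sq_le (w : E 4 → ℝ) (x : E 4) :
    ‖fderiv ℝ w x‖ ^ 2 ≤ 4 * ∑ j, pd j w x ^ 2 := by
  have h : ‖fderiv ℝ w x‖ ≤ ∑ j, |pd j w x| := by
    refine ContinuousLinearMap.opNorm_le_bound _ (by positivity) fun v => ?_
    conv_lhs => rw [vec_sum v, map_sum]
    refine (norm_sum_le _ _).trans ?_
    rw [Finset.sum_mul]
    refine Finset.sum_le_sum fun j _ => ?_
    rw [map_smul, norm_smul, mul_comm]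
    exact mul_le_mul_of_nonneg_left (PiLp.norm_apply_le v j) (norm_nonneg _)
  have h2 := pow_le_pow_left₀ (norm_nonneg _) h 2
  have h3 := sq_sum_le_card_mul_sum_sq (s := (Finset.univ : Finset (Fin 4))) (f := fun j => |pd j w x|)
  simp only [sq_abs, Finset.card_univ, Fintype.card_fin] at h3
  refine h2.trans (h3.trans ?_)
  norm_num

theorem hess_sq_le {w : E 4 → ℝ} (hw : Sm w) (x : E 4) :
    ‖iteratedFDeriv ℝ 2 w x‖ ^ 2 ≤ 16 * ∑ j, ∑ i, pd i (pd j w) x ^ 2 := by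
  have h : ‖iteratedFDeriv ℝ 2 w x‖ ≤ ∑ j, ∑ i, |pd i (pd j w) x| := by
    refine ContinuousMultilinearMap.opNorm_le_bound (by positivity) fun m => ?_
    rw [iteratedFDeriv_two_apply]
    have e : fderiv ℝ (fderiv ℝ w) x (m 0) (m 1)
        = ∑ j, ∑ i, (m 1) j * ((m 0) i * pd i (pd j w) x) := by
      conv_lhs => rw [vec_sum (m 1), map_sum]
      refine Finset.sum_congr rfl fun j _ => ?_
      rw [map_smul, ← fderiv_pd hw, ← Finset.mul_sum, smul_eq_mul]
      congr 1
      conv_lhs => rw [vec_sum (m 0), map_sum]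
      exact Finset.sum_congr rfl fun i _ => by rw [map_smul, smul_eq_mul]; rfl
    rw [e]
    refine (norm_sum_le _ _).trans ?_
    rw [Finset.sum_mul]
    refine Finset.sum_le_sum fun j _ => ?_
    refine (norm_sum_le _ _).trans ?_
    rw [Finset.sum_mul]
    refine Finset.sum_le_sum fun i _ => ?_
    rw [norm_mul, norm_mul, Fin.prod_univ_two]
    have a0 := PiLp.norm_apply_le (m 0) i
    have a1 := PiLp.norm_apply_le (m 1) j
    rw [Real.norm_eq_abs (pd i (pd j w) x)]
    calc ‖(m 1) j‖ * (‖(m 0) i‖ * |pd i (pd j w) x|)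
        ≤ ‖m 1‖ * (‖m 0‖ * |pd i (pd j w) x|) := by gcongr
      _ = _ := by ring
  have h2 := pow_le_pow_left₀ (norm_nonneg _) h 2
  have h3 := sq_sum_le_card_mul_sum_sq (s := (Finset.univ : Finset (Fin 4)))
    (f := fun j => ∑ i, |pd i (pd j w) x|)
  have h4 : ∀ j, (∑ i, |pd i (pd j w) x|) ^ 2 ≤ 4 * ∑ i, pd i (pd j w) x ^ 2 := by
    intro j
    have := sq_sum_le_card_mul_sum_sq (s := (Finset.univ : Finset (Fin 4)))
      (f := fun i => |pd i (pd j w) x|)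
    simp only [sq_abs, Finset.card_univ, Fintype.card_fin] at this
    exact_mod_cast this
  have h5 : ∑ j, (∑ i, |pd i (pd j w) x|) ^ 2 ≤ 4 * ∑ j, ∑ i, pd i (pd j w) x ^ 2 := by
    rw [Finset.mul_sum]
    exact Finset.sum_le_sum fun j _ => h4 j
  simp only [Finset.card_univ, Fintype.card_fin] at h3
  push_cast at h3
  linarith

theorem H2_le {w : E 4 → ℝ} (hw : Sm w) :
    H2normSq w ≤ 16 * ∫ x in ball (0 : E 4) 1, Q w x := by
  unfold H2normSq
  rw [← integral_const_mul]
  have c0 := hw.continuous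
  have c1 : Continuous (fderiv ℝ w) := hw.continuous_fderiv (by simp)
  have c2 : Continuous (iteratedFDeriv ℝ 2 w) := hw.continuous_iteratedFDeriv (by norm_cast)
  apply setIntegral_mono_on
  · exact Sm.intg (by fun_prop)
  · exact Sm.intg (continuous_const.mul (contQ hw))
  · exact measurableSet_ball
  · intro x _
    have h1 := fderiv_sq_le w x
    have h2 := hess_sq_le hw x
    have h3 : 0 ≤ ∑ j, pd j w x ^ 2 := by positivity
    unfold Q
    nlinarith [sq_nonneg (w x)]

theorem Q_nonneg (w : E 4 → ℝ) (x : E 4) : 0 ≤ Q w x := by unfold Q; positivity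

theorem domQ0 (w : ℕ → E 4 → ℝ) : Dom w (fun i => Q (w i)) := by
  refine ⟨1, zero_le_one, fun i x _ => ?_⟩
  have h1 : 0 ≤ ∑ j, pd j (w i) x ^ 2 := by positivity
  have h2 : 0 ≤ ∑ j, ∑ k, pd k (pd j (w i)) x ^ 2 := by positivity
  unfold Q; nlinarith

theorem domQ1 (w : ℕ → E 4 → ℝ) (j : Fin 4) : Dom (fun i => pd j (w i)) (fun i => Q (w i)) := by
  refine ⟨1, zero_le_one, fun i x _ => ?_⟩
  have h1 : pd j (w i) x ^ 2 ≤ ∑ j, pd j (w i) x ^ 2 :=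
    Finset.single_le_sum (f := fun j => pd j (w i) x ^ 2) (fun _ _ => sq_nonneg _)
      (Finset.mem_univ j)
  have h2 : 0 ≤ ∑ j, ∑ k, pd k (pd j (w i)) x ^ 2 := by positivity
  unfold Q; nlinarith [sq_nonneg (w i x)]

theorem domQ2 (w : ℕ → E 4 → ℝ) (k j : Fin 4) :
    Dom (fun i => pd k (pd j (w i))) (fun i => Q (w i)) := by
  refine ⟨1, zero_le_one, fun i x _ => ?_⟩
  have h1 : 0 ≤ ∑ j, pd j (w i) x ^ 2 := by positivity
  have h2 : pd k (pd j (w i)) x ^ 2 ≤ ∑ k, pd k (pd j (w i)) x ^ 2 :=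
    Finset.single_le_sum (f := fun k => pd k (pd j (w i)) x ^ 2) (fun _ _ => sq_nonneg _)
      (Finset.mem_univ k)
  have h3 : ∑ k, pd k (pd j (w i)) x ^ 2 ≤ ∑ j, ∑ k, pd k (pd j (w i)) x ^ 2 :=
    Finset.single_le_sum (f := fun j => ∑ k, pd k (pd j (w i)) x ^ 2) (fun _ _ => by positivity)
      (Finset.mem_univ j)
  unfold Q; nlinarith [sq_nonneg (w i x)]

theorem dom_lap (w : ℕ → E 4 → ℝ) : Dom (fun i => lap 4 (w i)) (fun i => Q (w i)) :=
  Dom.sum (F := fun j i x => pd j (pd j (w i)) x) fun j => domQ2 w j j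

theorem dom_comm1 {φ : E 4 → ℝ} (hφ : Sm φ) {u G : ℕ → E 4 → ℝ} (h0 : Dom u G)
    (h1 : ∀ j, Dom (fun i => pd j (u i)) G) : Dom (fun i => comm1 φ (u i)) G := by
  refine Dom.add (Dom.sum (F := fun j i x => 2 * (pd j φ x * pd j (u i) x)) fun j => ?_)
    (h0.bmul (sm_lap hφ).continuous)
  exact ((h1 j).bmul (hφ.pd j).continuous).bmul (p := fun _ => 2) continuous_const

theorem dom_pd_comm1 {φ : E 4 → ℝ} (hφ : Sm φ) {w : ℕ → E 4 → ℝ} (hw : ∀ i, Sm (w i))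
    (k : Fin 4) : Dom (fun i => pd k (comm1 φ (w i))) (fun i => Q (w i)) := by
  have e : (fun i => pd k (comm1 φ (w i))) = fun i x =>
      (∑ j, 2 * (pd j φ x * pd k (pd j (w i)) x + pd k (pd j φ) x * pd j (w i) x))
      + (lap 4 φ x * pd k (w i) x + pd k (lap 4 φ) x * w i x) := by
    funext i x
    unfold comm1
    have s1 : ∀ j, Sm (fun y => 2 * (pd j φ y * pd j (w i) y)) := fun j =>
      contDiff_const.mul ((hφ.pd j).mul ((hw i).pd j))
    rw [pd_add (a := fun y => ∑ j, 2 * (pd j φ y * pd j (w i) y)) (ContDiff.sum fun j _ => s1 j)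
      ((sm_lap hφ).mul (hw i)), pd_sum s1,
      pd_mul (sm_lap hφ) (hw i)]
    congr 1
    refine Finset.sum_congr rfl fun j _ => ?_
    rw [pd_mul (a := fun _ => 2) contDiff_const ((hφ.pd j).mul ((hw i).pd j)),
      pd_mul (hφ.pd j) ((hw i).pd j)]
    simp [pd]
  rw [e]
  refine Dom.add (Dom.sum (F := fun j i x =>
    2 * (pd j φ x * pd k (pd j (w i)) x + pd k (pd j φ) x * pd j (w i) x)) fun j => ?_)
    (Dom.add ((domQ1 w k).bmul (sm_lap hφ).continuous)
      ((domQ0 w).bmul ((sm_lap hφ).pd k).continuous))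
  exact (((domQ2 w k j).bmul (hφ.pd j).continuous).add
    ((domQ1 w j).bmul ((hφ.pd j).pd k).continuous)).bmul (p := fun _ => 2) continuous_const

theorem stmt10 (f : ℕ → E 4 → ℝ) (u : ℕ → E 4 → ℝ) (hf : ∀ i, ContDiff ℝ (⊤ : ℕ∞) (f i))
    (hu : ∀ i, ContDiff ℝ (⊤ : ℕ∞) (u i))
    -- `u_i` is the biharmonic extension of `f_i` with zero Neumann boundary condition
    (hbih : ∀ i, ∀ x ∈ Metric.ball (0 : E 4) 1, lap 4 (lap 4 (u i)) x = 0)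
    (hbd' : ∀ i, ∀ x ∈ Metric.sphere (0 : E 4) 1, u i x = f i x)
    (hneu : ∀ i, ∀ x ∈ Metric.sphere (0 : E 4) 1, fderiv ℝ (u i) x x = 0)
    -- `u_i ⇀ 0` weakly in `H²(𝔹⁴)` : boundedness plus weak convergence against tests
    (hbdd : ∃ C : ℝ, ∀ i, H2normSq (u i) ≤ C)
    (hweak : ∀ v : E 4 → ℝ, ContDiff ℝ (⊤ : ℕ∞) v →
      Tendsto (fun i => ∫ x in Metric.ball (0 : E 4) 1, u i x * v x) atTop (nhds 0))
    -- `u_i → 0` in `H¹(𝔹⁴)`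
    (hH1 : Tendsto (fun i =>
      ∫ x in Metric.ball (0 : E 4) 1, ((u i x) ^ 2 + ‖fderiv ℝ (u i) x‖ ^ 2)) atTop (nhds 0))
    (φ : E 4 → ℝ) (hφ : ContDiff ℝ (⊤ : ℕ∞) φ)
    (hφneu : ∀ x ∈ Metric.sphere (0 : E 4) 1, fderiv ℝ φ x x = 0)
    (U : ℕ → E 4 → ℝ) (hU : ∀ i, ContDiff ℝ (⊤ : ℕ∞) (U i))
    -- `U_i` is the biharmonic extension of `φ f_i` with zero Neumann boundary condition
    (hUbih : ∀ i, ∀ x ∈ Metric.ball (0 : E 4) 1, lap 4 (lap 4 (U i)) x = 0)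
    (hUbd : ∀ i, ∀ x ∈ Metric.sphere (0 : E 4) 1, U i x = φ x * f i x)
    (hUneu : ∀ i, ∀ x ∈ Metric.sphere (0 : E 4) 1, fderiv ℝ (U i) x x = 0) :
    Tendsto (fun i => H2normSq (fun y => φ y * u i y - U i y)) atTop (nhds 0) := by
  set w : ℕ → E 4 → ℝ := fun i y => φ y * u i y - U i y with hwd
  have hw : ∀ i, Sm (w i) := fun i => (hφ.mul (hu i)).sub (hU i)
  have h0 : ∀ i, Van (w i) := by
    intro i x hx
    simp only [hwd]
    rw [hUbd i x hx, hbd' i x hx, sub_self]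
  have hn : ∀ i, ∀ x ∈ sphere (0 : E 4) 1, fderiv ℝ (w i) x x = 0 := by
    intro i x hx
    simp only [hwd]
    rw [fderiv_fun_sub ((Sm.diff hφ x).fun_mul (Sm.diff (hu i) x)) (Sm.diff (hU i) x),
      fderiv_fun_mul (Sm.diff hφ x) (Sm.diff (hu i) x)]
    simp [hneu i x hx, hφneu x hx, hUneu i x hx]
  have h1 : ∀ i j, Van (pd j (w i)) := fun i j => van_pd (hw i) (h0 i) (hn i) j
  set G : ℕ → E 4 → ℝ := fun i x => (u i x) ^ 2 + ‖fderiv ℝ (u i) x‖ ^ 2 with hG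
  have cG : ∀ i, Continuous (G i) := by
    intro i
    have c0 := (hu i).continuous
    have c1 : Continuous (fderiv ℝ (u i)) := (hu i).continuous_fderiv (by simp)
    simp only [hG]
    fun_prop
  have dG0 : Dom u G := ⟨1, zero_le_one, fun i x _ => by simp only [hG]; nlinarith [sq_nonneg ‖fderiv ℝ (u i) x‖]⟩
  have dG1 : ∀ j, Dom (fun i => pd j (u i)) G := fun j => ⟨1, zero_le_one, fun i x _ => by
    simp only [hG]; nlinarith [sq_nonneg (u i x), pd_sq_le (u i) j x]⟩
  have cQ : ∀ i, Continuous (Q (w i)) := fun i => contQ (hw i)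
  have nQ : ∀ i x, 0 ≤ Q (w i) x := fun i x => Q_nonneg _ _
  obtain ⟨C0, hC0⟩ := Dom.int (dom_comm1 hφ dG0 dG1) (dom_lap w)
    (fun i => (sm_comm1 hφ (hu i)).continuous) (fun i => (sm_lap (hw i)).continuous) cG cQ
    (1 / 210) (by norm_num) nQ
  have hk : ∀ k : Fin 4, ∃ C : ℝ, ∀ i, ∫ x in ball (0 : E 4) 1, pd k (comm1 φ (w i)) x * pd k (u i) x
      ≤ C * (∫ x in ball (0 : E 4) 1, G i x) + (1 / 210) * ∫ x in ball (0 : E 4) 1, Q (w i) x := by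
    intro k
    obtain ⟨C, hC⟩ := Dom.int (dG1 k) (dom_pd_comm1 hφ hw k)
      (fun i => (Sm.pd (hu i) k).continuous) (fun i => ((sm_comm1 hφ (hw i)).pd k).continuous) cG cQ
      (1 / 210) (by norm_num) nQ
    refine ⟨C, fun i => ?_⟩
    have := hC i
    simpa only [mul_comm (pd k (u i) _)] using this
  choose C hC using hk
  have fin : ∀ i, H2normSq (w i) ≤ 16 * 42 * (C0 + ∑ k, C k) * ∫ x in ball (0 : E 4) 1, G i x := by
    intro i
    have id := main_id hφ (hu i) (hU i) (w := w i) rfl (h0 i) (h1 i) (hbih i) (hUbih i)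
    have q := intQ (hw i) (h0 i) (h1 i)
    have s : ∑ k, ∫ x in ball (0 : E 4) 1, pd k (comm1 φ (w i)) x * pd k (u i) x
      ≤ ∑ k, (C k * (∫ x in ball (0 : E 4) 1, G i x)
        + (1 / 210) * ∫ x in ball (0 : E 4) 1, Q (w i) x) :=
      Finset.sum_le_sum fun k _ => hC k i
    rw [Finset.sum_add_distrib, ← Finset.sum_mul] at s
    simp only [Finset.sum_const, Finset.card_univ, Fintype.card_fin, nsmul_eq_mul] at s
    push_cast at s
    have := hC0 i
    have := H2_le (hw i)
    linarith
  have lim : Tendsto (fun i => 16 * 42 * (C0 + ∑ k, C k) * ∫ x in ball (0 : E 4) 1, G i x)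
      atTop (nhds 0) := by
    simpa using hH1.const_mul (16 * 42 * (C0 + ∑ k, C k))
  refine squeeze_zero (fun i => ?_) fin lim
  unfold H2normSq
  exact integral_nonneg fun x => by positivity
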